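/- arXiv:math/0508236 — 3 statements merged into one kernel-verified Lean document; each statement's English description precedes it below -/
import Mathlib

section
/- Let f : R → S and g : S → T be local homomorphisms between Noetherian local rings and let h = g ∘ f. If any two of the three maps f, g, h are scalar extensions, then so is the third; that is: (i) if f and g are scalar extensions then h is; (ii) if g and h are scalar extensions then f is; (iii) if f and h are scalar extensions then g is. -/
open IsLocalRing

/-- A local homomorphism `f : R → S` between local rings is a *scalar extension* if `S` is
faithfully flat as an `R`-module (via `f`) and `f` is unramified, i.e. the maximal ideal of `S`
is the extension of the maximal ideal of `R`. -/
def IsScalarExtension {R S : Type*} [CommRing R] [CommRing S] [IsLocalRing R] [IsLocalRing S]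
    (f : R →+* S) : Prop :=
  (letI : Algebra R S := f.toAlgebra; Module.FaithfullyFlat R S) ∧
    (maximalIdeal R).map f = maximalIdeal S

open scoped TensorProduct

namespace Ideal

variable {S : Type*} [CommRing S] (M : Type*) [AddCommGroup M] [Module S M]

/-- If `M ⊗ (I + (a)) → M ⊗ S` and `M ⊗ (I : a) → M ⊗ S` are injective, so is `M ⊗ I → M ⊗ S`. -/
lemma lTensor_subtype_injective_of_sup_span {I K : Ideal S} {a : S}
    (hK : ∀ s, s ∈ K ↔ s * a ∈ I) (hKM : Function.Injective (K.subtype.lTensor M))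
    (hIM : Function.Injective ((I ⊔ span {a}).subtype.lTensor M)) :
    Function.Injective (I.subtype.lTensor M) := by
  let i : I →ₗ[S] ↥(I ⊔ span {a}) := Submodule.inclusion le_sup_left
  let j : S →ₗ[S] ↥(I ⊔ span {a}) :=
    LinearMap.toSpanSingleton S _ ⟨a, mem_sup_right (mem_span_singleton_self a)⟩
  let p : K →ₗ[S] I := -(LinearMap.mulRight S a).restrict fun s hs ↦ (hK s).mp hs
  have hp (s : K) : (p s : S) = -(s * a) := rfl
  have hex : Function.Exact (p.prod K.subtype) (i.coprod j) := by
    rintro ⟨x, s⟩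
    have hij : i.coprod j (x, s) = 0 ↔ (x : S) + s * a = 0 := by
      rw [← Subtype.coe_inj]
      rfl
    rw [hij]
    constructor
    · intro h
      have hs : s ∈ K := (hK s).mpr ((eq_neg_of_add_eq_zero_right h) ▸ I.neg_mem x.2)
      exact ⟨⟨s, hs⟩, Prod.ext (Subtype.ext (eq_neg_of_add_eq_zero_left h).symm) rfl⟩
    · rintro ⟨t, ht⟩
      obtain ⟨rfl, rfl⟩ := Prod.ext_iff.mp ht
      simp [hp]
  have hsurj : Function.Surjective (i.coprod j) := by
    rintro ⟨y, hy⟩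
    obtain ⟨x, hx, z, hz, rfl⟩ := Submodule.mem_sup.mp hy
    obtain ⟨s, rfl⟩ := mem_span_singleton'.mp hz
    exact ⟨(⟨x, hx⟩, s), rfl⟩
  rw [injective_iff_map_eq_zero]
  intro y hy
  have hiy : i.lTensor M y = 0 := by
    apply hIM
    rw [map_zero, ← LinearMap.comp_apply, ← LinearMap.lTensor_comp]
    exact hy
  have hy' : (i.coprod j).lTensor M ((LinearMap.inl S I S).lTensor M y) = 0 := by
    rw [← LinearMap.comp_apply, ← LinearMap.lTensor_comp, LinearMap.coprod_inl, hiy]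
  obtain ⟨z, hz⟩ := (lTensor_exact M hex hsurj _).mp hy'
  have hz0 : z = 0 := by
    apply hKM
    have := congr((LinearMap.snd S I S).lTensor M $hz)
    simp only [← LinearMap.comp_apply, ← LinearMap.lTensor_comp] at this
    simpa using this
  have := congr((LinearMap.fst S I S).lTensor M $hz)
  rw [hz0, map_zero, map_zero, ← LinearMap.comp_apply, ← LinearMap.lTensor_comp] at this
  simpa using this.symm

/-- If `M ⊗ m → M ⊗ S` is injective for the maximal ideal `m`, then so is `M ⊗ I → M ⊗ S` for
every ideal `I` containing a power of `m`. -/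
lemma lTensor_subtype_injective_of_pow_le [IsNoetherianRing S] [IsLocalRing S]
    (hM : Function.Injective ((maximalIdeal S).subtype.lTensor M)) (k : ℕ) (I : Ideal S)
    (hI : maximalIdeal S ^ k ≤ I) : Function.Injective (I.subtype.lTensor M) := by
  induction I using IsNoetherian.induction with | hgt I ih
  by_cases hItop : I = ⊤
  · subst hItop
    exact (LinearEquiv.lTensor M (Submodule.topEquiv (R := S) (M := S))).injective
  classical
  have hex : ∃ n, maximalIdeal S ^ n ≤ I := ⟨k, hI⟩
  obtain ⟨n, hn⟩ : ∃ n, Nat.find hex = n + 1 := by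
    refine Nat.exists_eq_succ_of_ne_zero fun h0 ↦ hItop ?_
    simpa [h0] using Nat.find_spec hex
  have hle : maximalIdeal S ^ (n + 1) ≤ I := hn ▸ Nat.find_spec hex
  obtain ⟨a, ha, haI⟩ := SetLike.not_le_iff_exists.mp (Nat.find_min hex (m := n) (by omega))
  have hlt : I < I ⊔ span {a} :=
    lt_of_le_of_ne le_sup_left fun h ↦ haI (h ▸ mem_sup_right (mem_span_singleton_self a))
  refine lTensor_subtype_injective_of_sup_span M (fun s ↦ ⟨fun hs ↦ hle ?_, fun hs ↦ ?_⟩) hM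
    (ih _ hlt (hI.trans le_sup_left))
  · rw [pow_succ']
    exact mul_mem_mul hs ha
  · rw [mem_maximalIdeal, mem_nonunits_iff]
    exact fun hu ↦ haI ((unit_mul_mem_iff_mem I hu).mp hs)

end Ideal

namespace TensorProduct

/-- The kernel of `M ⊗ I → M ⊗ (I + K)` comes from `M ⊗ (I ∩ K)`, in the form needed for
filtration arguments. -/
lemma mem_range_lTensor_of_lTensor_inclusion_sup_eq_zero {S M P : Type*} [CommRing S]
    [AddCommGroup M] [Module S M] [AddCommGroup P] [Module S P] (I K : Submodule S P)
    (x : M ⊗[S] I)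
    (hx : (Submodule.inclusion (le_sup_left : I ≤ I ⊔ K)).lTensor M x = 0) :
    x ∈ LinearMap.range ((K.comap I.subtype).subtype.lTensor M) := by
  let q := (K.comap (I ⊔ K).subtype).mkQ ∘ₗ Submodule.inclusion (le_sup_left : I ≤ I ⊔ K)
  have hex : Function.Exact (K.comap I.subtype).subtype q := by
    intro y
    simp [q]
  have hsurj : Function.Surjective q := by
    intro y
    obtain ⟨⟨y, hy⟩, rfl⟩ := Submodule.mkQ_surjective _ y
    obtain ⟨u, hu, v, hv, rfl⟩ := Submodule.mem_sup.mp hy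
    refine ⟨⟨u, hu⟩, ?_⟩
    simp only [q, LinearMap.comp_apply, Submodule.mkQ_apply]
    rw [Submodule.Quotient.eq]
    simpa using hv
  refine (lTensor_exact M hex hsurj x).mp ?_
  rw [LinearMap.lTensor_comp, LinearMap.comp_apply, hx, map_zero]

/-- Tensors with second factor in `J • ⊤` lie in `JT • (T ⊗ P)`. -/
lemma lTensor_subtype_mem_map_smul_top {S T P : Type*} [CommRing S] [CommRing T] [Algebra S T]
    [AddCommGroup P] [Module S P] (J : Ideal S) (N : Submodule S P) (hN : N ≤ J • ⊤)
    (z : T ⊗[S] N) :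
    N.subtype.lTensor T z ∈ J.map (algebraMap S T) • (⊤ : Submodule T (T ⊗[S] P)) := by
  induction z with
  | zero => simp
  | add u v hu hv => simpa using add_mem hu hv
  | tmul t y =>
    rw [LinearMap.lTensor_tmul]
    refine Submodule.smul_induction_on (hN y.2) (p := fun y ↦ t ⊗ₜ[S] y ∈ _) ?_ ?_
    · intro a ha p _
      rw [tmul_smul, ← algebraMap_smul T a]
      exact Submodule.smul_mem_smul (Ideal.mem_map_of_mem _ ha) trivial
    · intro u v hu hv
      rw [tmul_add]
      exact add_mem hu hv

end TensorProduct

namespace Module.Flat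

open TensorProduct

/-- A case of the local criterion of flatness: a Noetherian local algebra `T` over a Noetherian
local ring `S` is flat as soon as `T ⊗ m → T ⊗ S` is injective. -/
theorem of_lTensor_maximalIdeal_injective (S T : Type*) [CommRing S] [CommRing T] [Algebra S T]
    [IsNoetherianRing S] [IsNoetherianRing T] [IsLocalRing S] [IsLocalRing T]
    [IsLocalHom (algebraMap S T)]
    (hT : Function.Injective ((maximalIdeal S).subtype.lTensor T)) : Module.Flat S T := by
  rw [iff_lTensor_injective']
  intro I
  rw [injective_iff_map_eq_zero]
  intro x hx
  have hmap : (maximalIdeal S).map (algebraMap S T) ≠ ⊤ :=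
    ne_top_of_le_ne_top (maximalIdeal.isMaximal T).ne_top
      (((local_hom_TFAE (algebraMap S T)).out 0 2).mp ‹_›)
  have hbot := Ideal.iInf_pow_smul_eq_bot_of_isLocalRing (M := T ⊗[S] I) _ hmap
  rw [← Submodule.mem_bot T, ← hbot, Submodule.mem_iInf]
  intro n
  obtain ⟨c, hc⟩ := (maximalIdeal S).exists_pow_inf_eq_pow_smul I
  have hx0 : (Submodule.inclusion
      (le_sup_left : I ≤ I ⊔ maximalIdeal S ^ (n + c))).lTensor T x = 0 := by
    apply Ideal.lTensor_subtype_injective_of_pow_le T hT (n + c) _ le_sup_right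
    rw [map_zero, ← LinearMap.comp_apply, ← LinearMap.lTensor_comp]
    exact hx
  obtain ⟨z, rfl⟩ := mem_range_lTensor_of_lTensor_inclusion_sup_eq_zero _ _ x hx0
  rw [← Ideal.map_pow]
  refine lTensor_subtype_mem_map_smul_top _ _ (fun y hy ↦ ?_) z
  have hy' : (y : S) ∈ maximalIdeal S ^ n • I := by
    have h := hc (n + c) (Nat.le_add_left _ _)
    rw [Nat.add_sub_cancel] at h
    refine Submodule.smul_mono le_rfl inf_le_right (h.le ⟨?_, y.2⟩)
    simpa using hy
  rw [← Submodule.comap_map_eq_of_injective I.injective_subtype (maximalIdeal S ^ n • ⊤),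
    Submodule.map_smul'', Submodule.map_subtype_top]
  exact hy'

variable (R S T : Type*) [CommRing R] [CommRing S] [CommRing T] [Algebra R S] [Algebra S T]
  [Algebra R T] [IsScalarTower R S T]

/-- If `S → T` is faithfully flat and `R → T` is flat, then `R → S` is flat. -/
theorem of_faithfullyFlat_of_isScalarTower [FaithfullyFlat S T] [Flat R T] : Flat R S := by
  rw [iff_lTensor_injective']
  intro I
  let F : S ⊗[R] I →ₗ[S] S ⊗[R] R := AlgebraTensorModule.lTensor S S I.subtype
  suffices Function.Injective F from this
  rw [← FaithfullyFlat.lTensor_injective_iff_injective S T]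
  have hcomp : AlgebraTensorModule.cancelBaseChange R S S T R ∘ F.lTensor T =
      I.subtype.lTensor T ∘ AlgebraTensorModule.cancelBaseChange R S S T I := by
    have : (AlgebraTensorModule.cancelBaseChange R S S T R).toLinearMap ∘ₗ F.lTensor T =
        AlgebraTensorModule.lTensor S T I.subtype ∘ₗ
          (AlgebraTensorModule.cancelBaseChange R S S T I).toLinearMap := by
      ext
      simp [F]
    exact congr(⇑$this)
  refine Function.Injective.of_comp
    (f := AlgebraTensorModule.cancelBaseChange R S S T R) ?_
  rw [hcomp]
  exact (lTensor_preserves_injective_linearMap _ I.injective_subtype).comp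
    (LinearEquiv.injective _)

/-- If `T` is flat over `R`, then `T ⊗[S] IS → T` is injective for every ideal `I` of `R`. -/
theorem lTensor_map_subtype_injective [Flat R T] (I : Ideal R) :
    Function.Injective ((I.map (algebraMap R S)).subtype.lTensor T) := by
  let J := I.map (algebraMap R S)
  let φ : I →ₗ[R] J :=
    (Algebra.linearMap R S).restrict (q := J.restrictScalars R)
      fun _ hr ↦ Ideal.mem_map_of_mem _ hr
  let ψ : S ⊗[R] I →ₗ[S] J := φ.liftBaseChange S
  have hψ₁ (r : I) : (ψ (1 ⊗ₜ r) : S) = algebraMap R S r := by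
    rw [show ψ (1 ⊗ₜ r) = φ r by rw [LinearMap.liftBaseChange_tmul, one_smul]]
    rfl
  have hψ : Function.Surjective ψ := by
    rw [← LinearMap.range_eq_top, ← (Submodule.map_injective_of_injective
      J.injective_subtype).eq_iff, Submodule.map_subtype_top]
    refine le_antisymm (Submodule.map_subtype_le _ _) (Ideal.map_le_iff_le_comap.mpr fun r hr ↦ ?_)
    exact ⟨ψ (1 ⊗ₜ ⟨r, hr⟩), ⟨_, rfl⟩, hψ₁ _⟩
  have hcomp : (TensorProduct.rid S T ∘ J.subtype.lTensor T) ∘ ψ.lTensor T =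
      (TensorProduct.rid R T ∘ I.subtype.lTensor T) ∘
        AlgebraTensorModule.cancelBaseChange R S S T I := by
    have : ((TensorProduct.rid S T).toLinearMap ∘ₗ J.subtype.lTensor T) ∘ₗ ψ.lTensor T =
        ((AlgebraTensorModule.rid R S T).toLinearMap ∘ₗ
          AlgebraTensorModule.lTensor S T I.subtype) ∘ₗ
          (AlgebraTensorModule.cancelBaseChange R S S T I).toLinearMap := by
      ext
      simp [hψ₁]
    exact congr(⇑$this)
  refine Function.Injective.of_comp (f := TensorProduct.rid S T) ?_
  refine Function.Injective.of_comp_right ?_ (LinearMap.lTensor_surjective T hψ)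
  rw [hcomp]
  exact ((LinearEquiv.injective _).comp
    (lTensor_preserves_injective_linearMap _ I.injective_subtype)).comp (LinearEquiv.injective _)

end Module.Flat


/-- in a commuting triangle of local homomorphisms of Noetherian local rings,
if any two of `f`, `g`, `g ∘ f` are scalar extensions, then so is the third. -/
theorem scalarExtension_two_out_of_three
    {R S T : Type*} [CommRing R] [CommRing S] [CommRing T]
    [IsNoetherianRing R] [IsNoetherianRing S] [IsNoetherianRing T]
    [IsLocalRing R] [IsLocalRing S] [IsLocalRing T]
    (f : R →+* S) (g : S →+* T) (h : R →+* T)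
    (hf : IsLocalHom f) (hg : IsLocalHom g) (hfg : h = g.comp f) :
    (IsScalarExtension f → IsScalarExtension g → IsScalarExtension h) ∧
    (IsScalarExtension g → IsScalarExtension h → IsScalarExtension f) ∧
    (IsScalarExtension f → IsScalarExtension h → IsScalarExtension g) := by
  subst hfg
  algebraize [f, g, g.comp f]
  have : IsLocalHom (algebraMap R S) := hf
  have : IsLocalHom (algebraMap S T) := hg
  have : IsLocalHom (algebraMap R T) := RingHom.isLocalHom_comp g f
  have hmap : (maximalIdeal R).map (g.comp f) = ((maximalIdeal R).map f).map g :=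
    (Ideal.map_map f g).symm
  refine ⟨fun ⟨hf₁, hf₂⟩ ⟨hg₁, hg₂⟩ ↦ ⟨Module.FaithfullyFlat.trans R S T, ?_⟩,
    fun ⟨hg₁, hg₂⟩ ⟨hh₁, hh₂⟩ ↦ ⟨?_, ?_⟩, fun ⟨hf₁, hf₂⟩ ⟨hh₁, hh₂⟩ ↦ ⟨?_, ?_⟩⟩
  · rw [hmap, hf₂, hg₂]
  · have := Module.Flat.of_faithfullyFlat_of_isScalarTower R S T
    exact Module.FaithfullyFlat.of_flat_of_isLocalHom
  · apply Ideal.map_injective_of_faithfullyFlat (B := T)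
    exact hmap.symm.trans (hh₂.trans hg₂.symm)
  · have hinj := Module.Flat.lTensor_map_subtype_injective R S T (maximalIdeal R)
    have heq : (maximalIdeal R).map (algebraMap R S) = maximalIdeal S := hf₂
    rw [heq] at hinj
    have := Module.Flat.of_lTensor_maximalIdeal_injective S T hinj
    exact Module.FaithfullyFlat.of_flat_of_isLocalHom
  · rw [← hf₂, ← hmap, hh₂]
end

section
/- Let R be a Noetherian local ring with residue field κ, and let λ be a field extension of κ (a field equipped with a ring homomorphism κ → λ). Then there exists a Noetherian local R-algebra S such that R → S is a scalar extension, S is complete in its maximal-adic topology, and the residue field of S is isomorphic to λ compatibly with the embedding κ → λ. -/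
open IsLocalRing

universe u v

section

open Polynomial

theorem isNoetherianRing_reesAlgebra_quotient {A : Type*} [CommRing A] {I : Ideal A} (hI : I.FG)
    [IsNoetherianRing (A ⧸ I)] :
    IsNoetherianRing (reesAlgebra I ⧸ I.map (algebraMap A (reesAlgebra I))) := by
  have : Algebra.FiniteType A (reesAlgebra I) :=
    (reesAlgebra I).fg_iff_finiteType.mp (reesAlgebra.fg hI)
  have : Algebra.FiniteType (A ⧸ I) (reesAlgebra I ⧸ I.map (algebraMap A (reesAlgebra I))) :=
    .of_restrictScalars_finiteType A (A ⧸ I) _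
  exact Algebra.FiniteType.isNoetherianRing (A ⧸ I)
    (reesAlgebra I ⧸ I.map (algebraMap A (reesAlgebra I)))

theorem reesAlgebra.coeff_mem_of_mem_map {A : Type*} [CommRing A] {I : Ideal A}
    {p : reesAlgebra I} (hp : p ∈ I.map (algebraMap A (reesAlgebra I))) (d : ℕ) :
    (p : A[X]).coeff d ∈ I ^ (d + 1) := by
  induction hp using Submodule.span_induction generalizing d with
  | mem x hx =>
    obtain ⟨a, ha, rfl⟩ := hx
    change (C a).coeff d ∈ _
    rw [coeff_C]
    split_ifs with h
    · simpa [h] using ha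
    · exact zero_mem _
  | zero => simp
  | add x y _ _ hx hy => simpa using add_mem (hx d) (hy d)
  | smul r x _ hx' =>
    rw [smul_eq_mul, MulMemClass.coe_mul, coeff_mul]
    refine sum_mem fun ij hij => ?_
    rw [← Finset.HasAntidiagonal.mem_antidiagonal.mp hij, add_assoc, pow_add]
    exact Ideal.mul_mem_mul (r.2 _) (hx' _)

/-- Initial forms of an ideal `J` with respect to the `I`-adic filtration are finitely generated. -/
theorem Ideal.exists_initial_generators {A : Type*} [CommRing A] {I : Ideal A} (hI : I.FG)
    [IsNoetherianRing (A ⧸ I)] (J : Ideal A) :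
    ∃ (n : ℕ) (f : Fin n → A) (N : ℕ), (∀ k, f k ∈ J) ∧ ∀ d, ∀ x ∈ J, x ∈ I ^ d →
      ∃ c : Fin n → A, (∀ k, c k ∈ I ^ (d - N)) ∧ x - ∑ k, c k * f k ∈ I ^ (d + 1) := by
  have := isNoetherianRing_reesAlgebra_quotient hI
  let G := reesAlgebra I ⧸ I.map (algebraMap A (reesAlgebra I))
  let π : reesAlgebra I →+* G := Ideal.Quotient.mk (I.map (algebraMap A (reesAlgebra I)))
  let L : Set G := {g | ∃ (d : ℕ) (x : A) (hx : x ∈ I ^ d), x ∈ J ∧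
    π ⟨monomial d x, reesAlgebra.monomial_mem.2 hx⟩ = g}
  obtain ⟨t, htL, ht⟩ := (Submodule.fg_span_iff_fg_span_finset_subset L).mp
    (IsNoetherian.noetherian (Ideal.span L))
  choose d x hx hxJ hπ using fun g : t => htL g.2
  let e := t.equivFin
  refine ⟨t.card, fun k => x (e.symm k), Finset.univ.sup d, fun k => hxJ _, fun m y hyJ hy => ?_⟩
  have hmem : π ⟨monomial m y, reesAlgebra.monomial_mem.2 hy⟩ ∈ Submodule.span G (t : Set G) := by
    rw [← ht]; exact Submodule.subset_span ⟨m, y, hy, hyJ, rfl⟩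
  obtain ⟨h, hh⟩ := Submodule.mem_span_finset'.mp hmem
  choose h' hh' using fun g => Ideal.Quotient.mk_surjective (h g)
  refine ⟨fun k => if d (e.symm k) ≤ m then (h' (e.symm k) : A[X]).coeff (m - d (e.symm k)) else 0,
    fun k => ?_, ?_⟩
  · dsimp only
    split_ifs
    · exact Ideal.pow_le_pow_right (Nat.sub_le_sub_left (Finset.le_sup (Finset.mem_univ _)) m)
        ((h' _).2 _)
    · exact zero_mem _
  · have hz : (⟨monomial m y, reesAlgebra.monomial_mem.2 hy⟩ : reesAlgebra I) -
        ∑ g, h' g * ⟨monomial (d g) (x g), reesAlgebra.monomial_mem.2 (hx g)⟩ ∈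
        I.map (algebraMap A (reesAlgebra I)) := by
      rw [← Ideal.Quotient.eq_zero_iff_mem, map_sub, map_sum, sub_eq_zero]
      refine hh.symm.trans (Finset.sum_congr rfl fun g _ => ?_)
      rw [map_mul, hh', smul_eq_mul, ← hπ]
    have := reesAlgebra.coeff_mem_of_mem_map hz m
    rw [e.symm.sum_comp (fun g => (if d g ≤ m then (h' g : A[X]).coeff (m - d g) else 0) * x g)]
    simp only [AddSubgroupClass.coe_sub, AddSubmonoidClass.coe_finsetSum, MulMemClass.coe_mul,
      coeff_sub, finsetSum_coeff, ← C_mul_X_pow_eq_monomial, ← mul_assoc,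
      coeff_mul_X_pow', coeff_mul_C] at this
    simpa only [ite_mul, zero_mul, le_refl, if_true, Nat.sub_self, coeff_C_zero] using this

end

/-- A ring which is complete with respect to a finitely generated ideal `I` is Noetherian as soon as
`A ⧸ I` is. -/
theorem isNoetherianRing_of_isAdicComplete {A : Type*} [CommRing A] (I : Ideal A)
    [IsAdicComplete I A] (hI : I.FG) [IsNoetherianRing (A ⧸ I)] : IsNoetherianRing A := by
  refine (isNoetherianRing_iff_ideal_fg A).mpr fun J => ?_
  obtain ⟨n, f, N, hf, hstep⟩ := Ideal.exists_initial_generators hI J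
  suffices h : ∀ x ∈ J, ∃ c : Fin n → A, x = ∑ k, c k * f k by
    refine (Submodule.fg_iff_exists_fin_generating_family).mpr ⟨n, f, le_antisymm ?_ fun x hx => ?_⟩
    · exact Submodule.span_le.mpr (Set.range_subset_iff.mpr hf)
    · obtain ⟨c, rfl⟩ := h x hx
      exact sum_mem fun k _ => Ideal.mul_mem_left _ _ (Submodule.subset_span ⟨k, rfl⟩)
  intro x hx
  choose! c hcI hc using hstep
  -- `C d` approximates the coefficients of `x` to order `d`
  let C : ℕ → Fin n → A := Nat.rec 0 fun d b => b + c d (x - ∑ k, b k * f k)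
  have hC : ∀ d, C (d + 1) = C d + c d (x - ∑ k, C d k * f k) := fun d => rfl
  have hJ : ∀ d, x - ∑ k, C d k * f k ∈ J := fun d =>
    sub_mem hx (sum_mem fun k _ => J.mul_mem_left _ (hf k))
  have hrem : ∀ d, x - ∑ k, C d k * f k ∈ I ^ d := by
    intro d
    induction d with
    | zero => simp
    | succ d ih =>
      have := hc d _ (hJ d) ih
      rw [sub_sub, ← Finset.sum_add_distrib] at this
      simpa [hC, add_mul] using this
  have hcauchy : ∀ k {a b : ℕ}, a ≤ b →
      C (a + N) k ≡ C (b + N) k [SMOD (I ^ a • ⊤ : Submodule A A)] := by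
    intro k a b hab
    induction b, hab using Nat.le_induction with
    | base => rfl
    | succ b hab ih =>
      refine ih.trans (SModEq.symm (SModEq.sub_mem.mpr ?_))
      rw [add_right_comm, hC, Pi.add_apply, add_sub_cancel_left, smul_eq_mul, Ideal.mul_top]
      exact Ideal.pow_le_pow_right (by omega) (hcI _ _ (hJ _) (hrem _) k)
  choose l hl using fun k => IsPrecomplete.prec' _ (hcauchy k)
  refine ⟨l, sub_eq_zero.mp (IsHausdorff.haus (I := I) inferInstance _ fun d => ?_)⟩
  rw [SModEq.zero, smul_eq_mul, Ideal.mul_top]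
  have : x - ∑ k, l k * f k = (x - ∑ k, C (d + N) k * f k) + ∑ k, (C (d + N) k - l k) * f k := by
    simp [sub_mul]
  rw [this]
  refine add_mem (Ideal.pow_le_pow_right (by omega) (hrem _)) (sum_mem fun k _ =>
    Ideal.mul_mem_right _ _ ?_)
  simpa using SModEq.sub_mem.mp (hl k d)

/-- If a Noetherian local ring `T` agrees with a flat `R`-algebra `S` modulo all powers of an ideal
`I` of `R` contained in the maximal ideal of `T`, then `T` is flat over `R`. -/
theorem Module.Flat.of_approximation {R S T : Type*} [CommRing R] [IsNoetherianRing R] [CommRing S]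
    [CommRing T] [Algebra R S] [Algebra R T] [Module.Flat R S] [IsNoetherianRing T] [IsLocalRing T]
    (g : S →ₐ[R] T) (I : Ideal R) (hI : I.map (algebraMap R T) ≤ maximalIdeal T)
    (hsurj : ∀ n t, ∃ s, t - g s ∈ (I ^ n).map (algebraMap R T))
    (hinj : ∀ n, ((I ^ n).map (algebraMap R T)).comap g ≤ (I ^ n).map (algebraMap R S)) :
    Module.Flat R T := by
  refine Module.Flat.of_forall_isTrivialRelation fun {r f x} hx => ?_
  let rel : Submodule R (Fin r → R) := LinearMap.ker (Fintype.linearCombination R f)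
  have hrel : ∀ v, v ∈ rel ↔ ∑ i, f i * v i = 0 := fun v => by
    simp [rel, Fintype.linearCombination_apply, mul_comm]
  let ext : (Fin r → R) →ₗ[R] (Fin r → T) := (Algebra.linearMap R T).compLeft (Fin r)
  let K : Submodule T (Fin r → T) := Submodule.span T (ext '' rel)
  suffices hxK : x ∈ K by
    have : ∀ w ∈ K, Module.IsTrivialRelation f w := by
      intro w hw
      obtain ⟨k, y, hy⟩ := Submodule.mem_span_set'.mp hw
      obtain ⟨v, rfl⟩ := hy
      choose a ha hav using fun j => (v j).2
      refine ⟨k, fun i j => a j i, y, fun i => ?_, fun j => (hrel _).mp (ha j)⟩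
      simp [← hav, ext, Algebra.smul_def, mul_comm]
    exact this x hxK
  rw [← Submodule.Quotient.mk_eq_zero K]
  refine IsHausdorff.haus (I := maximalIdeal T) inferInstance _ fun n => ?_
  obtain ⟨k₀, hk₀⟩ := I.exists_pow_inf_eq_pow_smul (Ideal.span (Set.range f))
  let k := n + k₀
  obtain ⟨m, b, hb⟩ := Submodule.fg_iff_exists_fin_generating_family.mp
    (IsNoetherian.noetherian (I ^ k))
  choose s hs using fun i => hsurj k (x i)
  have hfs : ∑ i, f i • s i ∈ (I ^ k).map (algebraMap R S) := by
    refine hinj k ?_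
    have : g (∑ i, f i • s i) = - ∑ i, f i • (x i - g (s i)) := by
      simp [smul_sub, Finset.sum_sub_distrib, hx]
    rw [Ideal.mem_comap]
    change g _ ∈ _
    rw [this]
    exact neg_mem (sum_mem fun i _ => Submodule.smul_of_tower_mem _ _ (hs i))
  obtain ⟨y, hy⟩ : ∃ y : Fin m → S, ∑ i, f i • s i = ∑ j, b j • y j := by
    rw [← hb, Ideal.map_span, ← Set.range_comp, Ideal.mem_span_range_iff_exists_fun] at hfs
    obtain ⟨c, hc⟩ := hfs
    exact ⟨c, by rw [← hc]; simp [Algebra.smul_def, mul_comm]⟩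
  obtain ⟨p, α, z, hz, hα⟩ := Module.Flat.isTrivialRelation_of_sum_smul_eq_zero
    (f := Sum.elim f b) (x := Sum.elim s (-y)) (by simp [hy])
  have hu : ∀ l, ∃ u : Fin r → R, (∀ i, u i ∈ I ^ n) ∧ (fun i => α (Sum.inl i) l) - u ∈ rel := by
    intro l
    have h₁ : ∑ i, f i * α (Sum.inl i) l ∈ I ^ k := by
      have := hα l
      simp only [Fintype.sum_sum_type, Sum.elim_inl, Sum.elim_inr] at this
      rw [eq_neg_of_add_eq_zero_left this]
      refine neg_mem (sum_mem fun j _ => Ideal.mul_mem_right _ _ ?_)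
      rw [← hb]
      exact Submodule.subset_span ⟨j, rfl⟩
    have h₂ : ∑ i, f i * α (Sum.inl i) l ∈ I ^ n * Ideal.span (Set.range f) := by
      have h₃ : ∑ i, f i * α (Sum.inl i) l ∈ I ^ k • ⊤ ⊓ Ideal.span (Set.range f) := by
        refine ⟨by simpa using h₁, sum_mem fun i _ => Ideal.mul_mem_right _ _ ?_⟩
        exact Ideal.subset_span ⟨i, rfl⟩
      rw [hk₀ k (by omega), Nat.add_sub_cancel] at h₃
      exact Submodule.smul_mono le_rfl inf_le_right h₃
    obtain ⟨u, hu, hus⟩ := (Submodule.mem_ideal_smul_span_iff_exists_sum _ f _).mp h₂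
    refine ⟨u, hu, (hrel _).mpr ?_⟩
    rw [Finsupp.sum_fintype _ _ (by simp)] at hus
    simp [mul_sub, Finset.sum_sub_distrib, ← hus, mul_comm]
  choose u huI hu using hu
  have hw : (fun i => g (s i)) - ∑ l, g (z l) • ext (u l) ∈ K := by
    have : (fun i => g (s i)) - ∑ l, g (z l) • ext (u l) =
        ∑ l, g (z l) • ext ((fun i => α (Sum.inl i) l) - u l) := by
      ext i
      have := hz (Sum.inl i)
      simp only [Sum.elim_inl] at this
      simp [this, ext, Algebra.smul_def, mul_comm, mul_sub]
    rw [this]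
    exact sum_mem fun l _ => K.smul_mem _ (Submodule.subset_span ⟨_, hu l, rfl⟩)
  have hpow : ∀ e ≥ n, (I ^ e).map (algebraMap R T) ≤ maximalIdeal T ^ n := fun e he => by
    rw [Ideal.map_pow]
    exact (Ideal.pow_right_mono hI e).trans (Ideal.pow_le_pow_right he)
  have hx' : x - ((fun i => g (s i)) - ∑ l, g (z l) • ext (u l)) ∈
      (maximalIdeal T ^ n • ⊤ : Submodule T (Fin r → T)) := by
    have hpi : ∀ (J : Ideal T) (v : Fin r → T), (∀ i, v i ∈ J) →
        v ∈ (J • ⊤ : Submodule T (Fin r → T)) := fun J v hv => by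
      rw [pi_eq_sum_univ' v]
      exact sum_mem fun i _ => Submodule.smul_mem_smul (hv i) trivial
    refine hpi _ _ fun i => ?_
    have : (x - ((fun i => g (s i)) - ∑ l, g (z l) • ext (u l))) i =
        (x i - g (s i)) + ∑ l, g (z l) * algebraMap R T (u l i) := by
      simp [ext, sub_add]
    rw [this]
    exact add_mem (hpow k (by omega) (hs i)) (sum_mem fun l _ => Ideal.mul_mem_left _ _
      (hpow n le_rfl (Ideal.mem_map_of_mem _ (huI l i))))
  rw [SModEq.zero, ← sub_zero (Submodule.Quotient.mk x), ← (Submodule.Quotient.mk_eq_zero K).mpr hw,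
    ← Submodule.Quotient.mk_sub]
  have := Submodule.mem_map_of_mem (f := K.mkQ) hx'
  rw [Submodule.map_smul''] at this
  exact Submodule.smul_mono le_rfl le_top this

namespace MvPolynomial

variable {R σ : Type*} [CommRing R] [LinearOrder σ]

/-- Given polynomials `G a` in one variable whose coefficients involve only the variables `X b`
with `b < a`, the polynomial in all the variables obtained from `G a` by inserting `X a`. -/
noncomputable def triangular (G : ∀ a : σ, Polynomial (MvPolynomial (Set.Iio a) R)) (a : σ) :
    MvPolynomial σ R :=
  (G a).eval₂ (rename (R := R) (Subtype.val : Set.Iio a → σ)).toRingHom (X a)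

theorem map_triangular {S : Type*} [CommRing S] [Algebra R S]
    (G : ∀ a : σ, Polynomial (MvPolynomial (Set.Iio a) R)) (φ : MvPolynomial σ R →ₐ[R] S) (a : σ) :
    φ (triangular G a) =
      (G a).eval₂ (aeval fun b : Set.Iio a => φ (X b)).toRingHom (φ (X a)) := by
  have := Polynomial.hom_eval₂ (G a) (rename (R := R) (Subtype.val : Set.Iio a → σ)).toRingHom
    φ.toRingHom (X a)
  refine this.trans ?_
  congr 1
  have : φ.comp (rename (R := R) (Subtype.val : Set.Iio a → σ)) =
    aeval fun b : Set.Iio a => φ (X b) := by ext; simp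
  exact congrArg AlgHom.toRingHom this

theorem flat_quotient_triangular_finset {G : ∀ a : σ, Polynomial (MvPolynomial (Set.Iio a) R)}
    (hG : ∀ a, (G a).Monic) (s : Finset σ) :
    Module.Flat R (MvPolynomial σ R ⧸ Ideal.span (triangular G '' s)) := by
  classical
  induction s using Finset.induction_on_max with
  | empty =>
    have h : Ideal.span (triangular G '' (∅ : Finset σ)) = ⊥ := by simp
    rw [h]
    exact .of_linearEquiv (AlgEquiv.quotientBot R (MvPolynomial σ R)).toLinearEquiv
  | insert a s has ih =>
    let J := Ideal.span (triangular G '' s)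
    let J' := Ideal.span (triangular G '' (insert a s : Finset σ))
    let q : MvPolynomial σ R →ₐ[R] MvPolynomial σ R ⧸ J := Ideal.Quotient.mkₐ R J
    let q' : MvPolynomial σ R →ₐ[R] MvPolynomial σ R ⧸ J' := Ideal.Quotient.mkₐ R J'
    let p : Polynomial (MvPolynomial σ R ⧸ J) :=
      (G a).map (aeval fun b : Set.Iio a => q (X b)).toRingHom
    have hp : p.Monic := (hG a).map _
    have := hp.free_adjoinRoot
    have : Module.Flat R (AdjoinRoot p) := .trans R (MvPolynomial σ R ⧸ J) _
    have hJ : J ≤ J' := Ideal.span_mono (Set.image_mono (by simp))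
    let φ : MvPolynomial σ R →ₐ[R] AdjoinRoot p :=
      aeval fun b => if b = a then AdjoinRoot.root p else AdjoinRoot.of p (q (X b))
    have hφ : ∀ b ∈ insert a s, φ (triangular G b) = 0 := by
      intro b hb
      rcases Finset.mem_insert.mp hb with rfl | hb
      · have hφX : φ (X b) = AdjoinRoot.root p := by simp [φ]
        have hφlt : (aeval fun c : Set.Iio b => φ (X c)).toRingHom =
            (AdjoinRoot.of p).comp (aeval (R := R) fun c : Set.Iio b => q (X c)).toRingHom := by
          have (c : Set.Iio b) : (c : σ) ≠ b := ne_of_lt c.2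
          refine MvPolynomial.ringHom_ext (fun r => ?_) fun c => ?_
          · simp [IsScalarTower.algebraMap_apply R (MvPolynomial σ R ⧸ J) (AdjoinRoot p)]
          · simp [φ, this c]
        rw [map_triangular, hφX, hφlt, ← Polynomial.eval₂_map]
        exact AdjoinRoot.eval₂_root p
      · have hφlt (c) (hc : c ≤ b) : φ (X c) = (AdjoinRoot.ofAlgHom R p).comp q (X c) := by
          simp [φ, (hc.trans_lt (has b hb)).ne]
        rw [map_triangular, hφlt b le_rfl]
        simp_rw [fun c : Set.Iio b => hφlt c (le_of_lt c.2)]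
        rw [← map_triangular, AlgHom.comp_apply]
        have : q (triangular G b) = 0 :=
          Ideal.Quotient.eq_zero_iff_mem.mpr (Ideal.subset_span ⟨b, hb, rfl⟩)
        rw [this, map_zero]
    let i : (MvPolynomial σ R ⧸ J') →ₐ[R] AdjoinRoot p := Ideal.Quotient.liftₐ J' φ fun x hx => by
      have : J' ≤ RingHom.ker φ := by
        refine Ideal.span_le.mpr ?_
        rintro _ ⟨b, hb, rfl⟩
        exact hφ b hb
      exact this hx
    let r : AdjoinRoot p →ₐ[R] MvPolynomial σ R ⧸ J' :=
      AdjoinRoot.liftAlgHom p (Ideal.Quotient.factorₐ R hJ) (q' (X a)) (by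
        rw [Polynomial.eval₂_map]
        have : q' (triangular G a) = 0 :=
          Ideal.Quotient.eq_zero_iff_mem.mpr (Ideal.subset_span ⟨a, by simp, rfl⟩)
        rw [map_triangular] at this
        refine .trans ?_ this
        congr 1
        refine MvPolynomial.ringHom_ext (fun r => ?_) fun c => ?_
        · suffices Ideal.Quotient.factor hJ (algebraMap R _ r) = algebraMap R _ r by simpa
          exact (Ideal.Quotient.factorₐ R hJ).commutes r
        · simp [q, q'])
    have hri : r.comp i = AlgHom.id R _ := by
      refine Ideal.Quotient.algHom_ext _ (MvPolynomial.algHom_ext fun b => ?_)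
      change r (φ (X b)) = q' (X b)
      by_cases hb : b = a
      · simp [φ, r, hb]
      · simp [φ, r, hb, q, q']
    exact Module.Flat.of_retract i.toLinearMap r.toLinearMap (congrArg AlgHom.toLinearMap hri)

theorem flat_quotient_triangular {G : ∀ a : σ, Polynomial (MvPolynomial (Set.Iio a) R)}
    (hG : ∀ a, (G a).Monic) :
    Module.Flat R (MvPolynomial σ R ⧸ Ideal.span (Set.range (triangular G))) := by
  refine Module.Flat.of_forall_isTrivialRelation fun {l f x} hx => ?_
  choose y hy using fun i => Ideal.Quotient.mk_surjective (x i)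
  have hmem : ∑ i, f i • y i ∈ Ideal.span (Set.range (triangular G)) := by
    rw [← Ideal.Quotient.eq_zero_iff_mem, ← hx, map_sum]
    refine Finset.sum_congr rfl fun i _ => ?_
    rw [← hy]
    rfl
  obtain ⟨s, hs⟩ : ∃ s : Finset σ, ∑ i, f i • y i ∈ Ideal.span (triangular G '' s) := by
    classical
    obtain ⟨t, ht, h⟩ := Submodule.mem_span_finite_of_mem_span hmem
    obtain ⟨s, -, rfl⟩ := Finset.subset_set_image_iff.mp (Set.image_univ ▸ ht)
    exact ⟨s, by simpa using h⟩
  have := flat_quotient_triangular_finset hG s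
  obtain ⟨k, a, z, hz, ha⟩ := Module.Flat.isTrivialRelation_of_sum_smul_eq_zero (f := f)
    (x := fun i => Ideal.Quotient.mkₐ R (Ideal.span (triangular G '' s)) (y i)) (by
      simp_rw [← map_smul, ← map_sum]
      exact Ideal.Quotient.eq_zero_iff_mem.mpr hs)
  have hle : Ideal.span (triangular G '' s) ≤ Ideal.span (Set.range (triangular G)) :=
    Ideal.span_mono (Set.image_subset_range _ _)
  refine ⟨k, a, fun j => Ideal.Quotient.factorₐ R hle (z j), fun i => ?_, ha⟩
  have := congrArg (Ideal.Quotient.factorₐ R hle) (hz i)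
  rw [map_sum] at this
  simpa [hy] using this

theorem exists_eq_C_or_eq_eval₂_X (p : MvPolynomial σ R) :
    (∃ r, p = C r) ∨ ∃ b ∈ p.vars, ∃ Q : Polynomial (MvPolynomial (Set.Iio b) R),
      p = Q.eval₂ (rename (R := R) (Subtype.val : Set.Iio b → σ)).toRingHom (X b) := by
  rcases p.vars.eq_empty_or_nonempty with h | h
  · exact .inl ⟨_, MvPolynomial.vars_eq_empty_iff_eq_C.mp h⟩
  · obtain ⟨b, hb, hle⟩ : ∃ b ∈ p.vars, ∀ c ∈ p.vars, c ≤ b :=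
      ⟨_, p.vars.max'_mem h, p.vars.le_max'⟩
    refine .inr ⟨b, hb, ?_⟩
    have hp : p ∈ supported R (Set.Iic b) := mem_supported.mpr hle
    rw [supported_eq_adjoin_X] at hp
    clear hb hle h
    induction hp using Algebra.adjoin_induction with
    | mem x hx =>
      obtain ⟨c, hc, rfl⟩ := hx
      rcases (Set.mem_Iic.mp hc).eq_or_lt with rfl | hc
      · exact ⟨.X, by simp⟩
      · exact ⟨.C (X ⟨c, hc⟩), by simp⟩
    | algebraMap r => exact ⟨.C (C r), by simp [algebraMap_eq]⟩
    | add p q _ _ hp hq =>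
      obtain ⟨P, hP⟩ := hp
      obtain ⟨Q, hQ⟩ := hq
      exact ⟨P + Q, by rw [Polynomial.eval₂_add, ← hP, ← hQ]⟩
    | mul p q _ _ hp hq =>
      obtain ⟨P, hP⟩ := hp
      obtain ⟨Q, hQ⟩ := hq
      exact ⟨P * Q, by rw [Polynomial.eval₂_mul, ← hP, ← hQ]⟩

/-- The kernel of the evaluation at a well-ordered family of algebraic elements is generated, up to
constants, by a triangular system of monic polynomials. -/
theorem exists_triangular_presentation [WellFoundedLT σ] (K : Type*) {L : Type*} [Field K]
    [Field L] [Algebra R K] [Algebra R L] [Algebra K L] [IsScalarTower R K L]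
    [Algebra.IsAlgebraic K L] (hRK : Function.Surjective (algebraMap R K)) (x : σ → L) :
    ∃ G : ∀ a : σ, Polynomial (MvPolynomial (Set.Iio a) R), (∀ a, (G a).Monic) ∧
      (∀ a, aeval x (triangular G a) = 0) ∧
      RingHom.ker (aeval (R := R) x) ≤
        (RingHom.ker (algebraMap R L)).map C ⊔ Ideal.span (Set.range (triangular G)) := by
  let E (a : σ) : IntermediateField K L := .adjoin K (x '' Set.Iio a)
  let θ (a : σ) : MvPolynomial (Set.Iio a) R →ₐ[R] E a :=
    aeval fun b => ⟨x b, IntermediateField.subset_adjoin _ _ ⟨b, b.2, rfl⟩⟩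
  have hθx (a : σ) : (algebraMap (E a) L).comp (θ a).toRingHom =
      (aeval (R := R) fun b : Set.Iio a => x b).toRingHom := by
    refine MvPolynomial.ringHom_ext (fun r => ?_) fun b => ?_
    · simp only [RingHom.comp_apply, AlgHom.toRingHom_eq_coe, RingHom.coe_coe, ← algebraMap_eq,
        AlgHom.commutes]
      rfl
    · simp [θ, IntermediateField.algebraMap_apply]
  have hθ (a : σ) : Function.Surjective (θ a) := by
    rintro ⟨y, hy⟩
    suffices ∃ q, algebraMap (E a) L (θ a q) = y from this.imp fun q hq => Subtype.ext hq
    have hq (q) : algebraMap (E a) L (θ a q) = aeval (R := R) (fun b : Set.Iio a => x b) q :=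
      RingHom.congr_fun (hθx a) q
    simp_rw [hq]
    rw [← IntermediateField.mem_toSubalgebra, IntermediateField.adjoin_toSubalgebra_of_isAlgebraic
      fun x _ => Algebra.IsAlgebraic.isAlgebraic x] at hy
    clear hq
    induction hy using Algebra.adjoin_induction with
    | mem y hy =>
      obtain ⟨b, hb, rfl⟩ := hy
      exact ⟨X ⟨b, hb⟩, by simp⟩
    | algebraMap k =>
      obtain ⟨r, rfl⟩ := hRK k
      exact ⟨C r, by simp [← IsScalarTower.algebraMap_apply]⟩
    | add y z _ _ hy hz =>
      obtain ⟨p, rfl⟩ := hy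
      obtain ⟨q, rfl⟩ := hz
      exact ⟨p + q, map_add _ _ _⟩
    | mul y z _ _ hy hz =>
      obtain ⟨p, rfl⟩ := hy
      obtain ⟨q, rfl⟩ := hz
      exact ⟨p * q, map_mul _ _ _⟩
  have hG (a : σ) : ∃ G : Polynomial (MvPolynomial (Set.Iio a) R),
      G.map (θ a).toRingHom = minpoly (E a) (x a) ∧ G.Monic := by
    have hint : IsIntegral (E a) (x a) := (Algebra.IsAlgebraic.isAlgebraic (x a)).isIntegral
    have hlift : minpoly (E a) (x a) ∈ Polynomial.lifts (θ a).toRingHom :=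
      Polynomial.mem_lifts _ |>.mpr (Polynomial.map_surjective _ (hθ a) _)
    obtain ⟨G, h, -, hm⟩ := Polynomial.lifts_and_degree_eq_and_monic hlift (minpoly.monic hint)
    exact ⟨G, h, hm⟩
  choose G hGmap hGmonic using hG
  refine ⟨G, hGmonic, fun a => ?_, ?_⟩
  · rw [map_triangular, aeval_X]
    simp_rw [aeval_X]
    rw [← hθx, ← Polynomial.eval₂_map, hGmap]
    exact minpoly.aeval _ _
  set N := (RingHom.ker (algebraMap R L)).map C ⊔ Ideal.span (Set.range (triangular G))
  have hC (r : R) (hr : aeval x (C r : MvPolynomial σ R) = 0) : (C r : MvPolynomial σ R) ∈ N :=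
    Ideal.mem_sup_left (Ideal.mem_map_of_mem _ (by simpa using hr))
  have heval (a : σ) : ∀ Q : Polynomial (MvPolynomial (Set.Iio a) R),
      aeval x (Q.eval₂ (rename (R := R) (Subtype.val : Set.Iio a → σ)).toRingHom (X a)) = 0 →
      Q.eval₂ (rename (R := R) (Subtype.val : Set.Iio a → σ)).toRingHom (X a) ∈ N := by
    induction a using WellFoundedLT.induction with
    | ind a ih =>
    have hlow (q : MvPolynomial (Set.Iio a) R) (hq : θ a q = 0) :
        rename (R := R) (Subtype.val : Set.Iio a → σ) q ∈ N := by
      classical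
      have h0 : aeval x (rename (R := R) (Subtype.val : Set.Iio a → σ) q) = 0 := by
        rw [aeval_rename]
        refine (RingHom.congr_fun (hθx a) q).symm.trans ?_
        simp [hq]
      rcases exists_eq_C_or_eq_eval₂_X (rename (R := R) (Subtype.val : Set.Iio a → σ) q) with
        ⟨r, hr⟩ | ⟨b, hb, Q, hQ⟩
      · rw [hr] at h0 ⊢
        exact hC r h0
      · obtain ⟨c, -, rfl⟩ := Finset.mem_image.mp (vars_rename _ _ hb)
        rw [hQ] at h0 ⊢
        exact ih c c.2 Q h0
    intro Q hQ
    obtain ⟨h, hh⟩ : minpoly (E a) (x a) ∣ Q.map (θ a).toRingHom := by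
      refine minpoly.dvd _ _ ?_
      rw [Polynomial.aeval_def, Polynomial.eval₂_map, hθx, ← hQ]
      refine .trans ?_ (Polynomial.hom_eval₂ Q _ (aeval x).toRingHom (X a)).symm
      congr 1
      · refine MvPolynomial.ringHom_ext (fun r => ?_) fun b => ?_ <;> simp
      · simp
    obtain ⟨H, rfl⟩ := Polynomial.map_surjective _ (hθ a) h
    have hZ : (Q - G a * H).map (θ a).toRingHom = 0 := by
      rw [Polynomial.map_sub, Polynomial.map_mul, hGmap, hh, sub_self]
    have : Q = (Q - G a * H) + G a * H := by ring
    rw [this, Polynomial.eval₂_add, Polynomial.eval₂_mul]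
    refine add_mem ?_ (Ideal.mul_mem_right _ _ ?_)
    · rw [Polynomial.eval₂_eq_sum_range]
      refine sum_mem fun i _ => Ideal.mul_mem_right _ _ (hlow _ ?_)
      have := congrArg (Polynomial.coeff · i) hZ
      simp only [Polynomial.coeff_map, Polynomial.coeff_zero] at this
      exact this
    · exact Ideal.mem_sup_right (Ideal.subset_span ⟨a, rfl⟩)
  intro p hp
  rcases exists_eq_C_or_eq_eval₂_X p with ⟨r, rfl⟩ | ⟨b, -, Q, rfl⟩
  · exact hC r hp
  · exact heval b Q hp

end MvPolynomial

universe w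

/-- The localisation of a flat algebra at the prime ideal `φ.ker` generated by the maximal ideal. -/
theorem exists_isLocalRing_of_ker_eq_map {R : Type u} {B : Type w} {L : Type*} [CommRing R]
    [IsLocalRing R] [CommRing B] [Algebra R B] [Module.Flat R B] [Field L] (φ : B →+* L)
    (hφ : RingHom.ker φ = (maximalIdeal R).map (algebraMap R B)) :
    ∃ (S : Type w) (_ : CommRing S) (_ : IsLocalRing S) (_ : Algebra R S),
      Module.Flat R S ∧ (maximalIdeal R).map (algebraMap R S) = maximalIdeal S ∧
      ∃ j : ResidueField S →+* L,
        (∀ r, j (residue S (algebraMap R S r)) = φ (algebraMap R B r)) ∧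
        ∀ b, φ b ∈ Set.range j := by
  let P := RingHom.ker φ
  have : P.IsPrime := RingHom.ker_isPrime φ
  let S := Localization.AtPrime P
  have hunit (y : P.primeCompl) : IsUnit (φ y) := isUnit_iff_ne_zero.mpr y.2
  let ψ : S →+* L := IsLocalization.lift hunit
  have hψ (b : B) : ψ (algebraMap B S b) = φ b := IsLocalization.lift_eq hunit b
  have hm : (maximalIdeal R).map (algebraMap R S) = maximalIdeal S := by
    rw [IsScalarTower.algebraMap_eq R B S, ← Ideal.map_map, ← hφ]
    exact Localization.AtPrime.map_eq_maximalIdeal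
  have hψm : ∀ s ∈ maximalIdeal S, ψ s = 0 := by
    have : maximalIdeal S ≤ RingHom.ker ψ := by
      rw [← Localization.AtPrime.map_eq_maximalIdeal, Ideal.map_le_iff_le_comap]
      exact fun b hb => (hψ b).trans hb
    exact this
  have : IsLocalHom ψ := ⟨fun s hs => by
    by_contra h
    exact hs.ne_zero (hψm s h)⟩
  have : Module.Flat B S := IsLocalization.flat S P.primeCompl
  refine ⟨S, inferInstance, inferInstance, inferInstance, .trans R B S, hm,
    ResidueField.lift ψ, fun r => ?_, fun b => ⟨residue S (algebraMap B S b), ?_⟩⟩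
  · rw [ResidueField.lift_residue_apply, IsScalarTower.algebraMap_apply R B S, hψ]
  · rw [ResidueField.lift_residue_apply, hψ]

theorem exists_isLocalRing_isAlgebraic_residueField {R : Type u} [CommRing R] [IsLocalRing R]
    {L : Type v} [Field L] (i : ResidueField R →+* L) :
    ∃ (S : Type (max u v)) (_ : CommRing S) (_ : IsLocalRing S) (_ : Algebra R S),
      Module.Flat R S ∧ (maximalIdeal R).map (algebraMap R S) = maximalIdeal S ∧
      ∃ j : ResidueField S →+* L, (∀ r, j (residue S (algebraMap R S r)) = i (residue R r)) ∧
        (let := j.toAlgebra; Algebra.IsAlgebraic (ResidueField S) L) := by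
  let := i.toAlgebra
  obtain ⟨s, hs⟩ := exists_isTranscendenceBasis (ResidueField R) L
  let φ : MvPolynomial s R →+* L := MvPolynomial.eval₂Hom (i.comp (residue R)) (↑)
  have hφ' : φ = (MvPolynomial.aeval (R := ResidueField R) ((↑) : s → L)).toRingHom.comp
      (MvPolynomial.map (residue R)) := by
    refine MvPolynomial.ringHom_ext (fun r => ?_) fun b => ?_
    · simp [φ, RingHom.algebraMap_toAlgebra]
    · simp [φ]
  have hφ : RingHom.ker φ = (maximalIdeal R).map (algebraMap R (MvPolynomial s R)) := by
    have hinj : Function.Injective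
      (MvPolynomial.aeval (R := ResidueField R) ((↑) : s → L)).toRingHom := hs.1
    rw [hφ', RingHom.ker_comp_of_injective _ hinj, MvPolynomial.ker_map, ker_residue]
    rfl
  obtain ⟨S, _, _, _, hflat, hm, j, hj, hrange⟩ := exists_isLocalRing_of_ker_eq_map φ hφ
  have hji (r) : j (residue S (algebraMap R S r)) = i (residue R r) := by
    rw [hj, MvPolynomial.algebraMap_eq, MvPolynomial.eval₂Hom_C]; rfl
  refine ⟨S, _, inferInstance, _, hflat, hm, j, hji, ?_⟩
  let := j.toAlgebra
  have halg := hs.isAlgebraic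
  let A := Algebra.adjoin (ResidueField R) (Set.range ((↑) : s → L))
  have hA : ∀ a ∈ A, a ∈ j.range := fun a ha => by
    induction ha using Algebra.adjoin_induction with
    | mem a ha =>
      obtain ⟨t, rfl⟩ := ha
      simpa [φ] using hrange (MvPolynomial.X t)
    | algebraMap k =>
      obtain ⟨r, rfl⟩ := residue_surjective k
      exact ⟨_, hji r⟩
    | add a b _ _ ha hb => exact add_mem ha hb
    | mul a b _ _ ha hb => exact mul_mem ha hb
  let ρ : ResidueField S ≃+* j.range :=
    .ofBijective j.rangeRestrict ⟨j.rangeRestrict.injective, j.rangeRestrict_surjective⟩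
  let f : A →+* ResidueField S :=
    ρ.symm.toRingHom.comp (A.toSubring.subtype.codRestrict j.range fun a => hA a a.2)
  have hf (a : A) : j (f a) = a := congrArg Subtype.val (ρ.apply_symm_apply ⟨a, hA a a.2⟩)
  exact Algebra.IsAlgebraic.ringHom_of_comp_eq f (RingHom.id L)
    (fun a b h => Subtype.ext (by rw [← hf a, h, hf b])) Function.surjective_id
    (RingHom.ext fun a => hf a)

/-- Every extension of the residue field of a local ring is realised by a flat unramified extension. -/
theorem exists_isLocalRing_of_residueField_hom {R : Type u} [CommRing R] [IsLocalRing R]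
    {L : Type v} [Field L] (i : ResidueField R →+* L) :
    ∃ (S : Type (max u v)) (_ : CommRing S) (_ : IsLocalRing S) (_ : Algebra R S),
      Module.Flat R S ∧ (maximalIdeal R).map (algebraMap R S) = maximalIdeal S ∧
      ∃ j : ResidueField S ≃+* L, ∀ r, j (residue S (algebraMap R S r)) = i (residue R r) := by
  obtain ⟨R', _, _, _, _, hm, j, hj, halg⟩ := exists_isLocalRing_isAlgebraic_residueField i
  let := j.toAlgebra
  let := (j.comp (residue R')).toAlgebra
  have : IsScalarTower R' (ResidueField R') L := .of_algebraMap_eq fun _ => rfl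
  obtain ⟨_, hwf⟩ := exists_wellFoundedLT L
  obtain ⟨G, hG, hG0, hker⟩ := MvPolynomial.exists_triangular_presentation (ResidueField R')
    residue_surjective (id : L → L)
  have := MvPolynomial.flat_quotient_triangular hG
  let J := Ideal.span (Set.range (MvPolynomial.triangular G))
  have hJ : J ≤ RingHom.ker (MvPolynomial.aeval (R := R') (id : L → L)) := by
    refine Ideal.span_le.mpr ?_
    rintro _ ⟨a, rfl⟩
    exact hG0 a
  let φ : MvPolynomial L R' ⧸ J →ₐ[R'] L := Ideal.Quotient.liftₐ J _ hJ
  have hkerL : RingHom.ker (algebraMap R' L) = maximalIdeal R' := by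
    rw [RingHom.algebraMap_toAlgebra, RingHom.ker_comp_of_injective _ j.injective, ker_residue]
  have hφ : RingHom.ker φ.toRingHom =
      (maximalIdeal R').map (algebraMap R' (MvPolynomial L R' ⧸ J)) := by
    refine le_antisymm (fun b hb => ?_) (Ideal.map_le_iff_le_comap.mpr fun r hr => ?_)
    · obtain ⟨p, rfl⟩ := Ideal.Quotient.mk_surjective b
      have := Ideal.mem_map_of_mem (Ideal.Quotient.mk J) (hker hb)
      rw [Ideal.map_sup, Ideal.map_quotient_self, sup_bot_eq, Ideal.map_map, hkerL] at this
      exact this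
    · rw [Ideal.mem_comap, RingHom.mem_ker]
      refine (φ.commutes r).trans ?_
      rwa [← RingHom.mem_ker, hkerL]
  obtain ⟨S, _, _, _, _, hmS, k, hk, hrange⟩ := exists_isLocalRing_of_ker_eq_map φ.toRingHom hφ
  let : Algebra R S := ((algebraMap R' S).comp (algebraMap R R')).toAlgebra
  have : IsScalarTower R R' S := .of_algebraMap_eq fun _ => rfl
  refine ⟨S, _, inferInstance, _, .trans R R' S, ?_, .ofBijective k ⟨k.injective, fun l => ?_⟩,
    fun r => ?_⟩
  · rw [IsScalarTower.algebraMap_eq R R' S, ← Ideal.map_map, hm, hmS]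
  · have : φ (Ideal.Quotient.mk J (.X l)) = l := MvPolynomial.aeval_X _ l
    exact this ▸ hrange (Ideal.Quotient.mk J (.X l))
  · refine (hk _).trans (.trans (φ.commutes _) (hj r))

theorem AdicCompletion.mem_map_pow_iff {A : Type*} [CommRing A] {I : Ideal A} (hI : I.FG) (n : ℕ)
    (t : AdicCompletion I A) :
    t ∈ (I ^ n).map (algebraMap A (AdicCompletion I A)) ↔ AdicCompletion.eval I A n t = 0 := by
  rw [← Submodule.restrictScalars_mem A, ← Ideal.smul_top_eq_map, pow_smul_top_eq_ker_eval hI,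
    LinearMap.mem_ker]

theorem AdicCompletion.isNoetherianRing_of_fg {S : Type*} [CommRing S] [IsLocalRing S]
    (hS : (maximalIdeal S).FG) : IsNoetherianRing (AdicCompletion (maximalIdeal S) S) := by
  have := AdicCompletion.isLocalRing_of_fg hS
  have := AdicCompletion.isAdicComplete_of_fg hS
  let m := maximalIdeal (AdicCompletion (maximalIdeal S) S)
  have : IsNoetherianRing (AdicCompletion (maximalIdeal S) S ⧸ m) :=
    inferInstanceAs (IsNoetherianRing (ResidueField (AdicCompletion (maximalIdeal S) S)))
  refine isNoetherianRing_of_isAdicComplete m ?_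
  have hm : m = _ := AdicCompletion.maximalIdeal_eq_map_of_fg hS
  exact hm ▸ Ideal.FG.map hS _

theorem AdicCompletion.flat_of_map_maximalIdeal_eq {R S : Type*} [CommRing R] [IsNoetherianRing R]
    [IsLocalRing R] [CommRing S] [IsLocalRing S] [Algebra R S] [Module.Flat R S]
    (h : (maximalIdeal R).map (algebraMap R S) = maximalIdeal S) :
    Module.Flat R (AdicCompletion (maximalIdeal S) S) := by
  have hS : (maximalIdeal S).FG := h ▸ (maximalIdeal R).fg_of_isNoetherianRing.map _
  have := AdicCompletion.isLocalRing_of_fg hS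
  have := AdicCompletion.isNoetherianRing_of_fg hS
  have hpow (n : ℕ) : (maximalIdeal R ^ n).map
      (algebraMap R (AdicCompletion (maximalIdeal S) S)) =
      (maximalIdeal S ^ n).map (algebraMap S (AdicCompletion (maximalIdeal S) S)) := by
    rw [IsScalarTower.algebraMap_eq R S (AdicCompletion (maximalIdeal S) S), ← Ideal.map_map,
      Ideal.map_pow, h]
  refine .of_approximation (IsScalarTower.toAlgHom R S _) (maximalIdeal R) ?_ (fun n t => ?_)
    fun n s hs => ?_
  · rw [AdicCompletion.maximalIdeal_eq_map_of_fg hS]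
    simpa using (hpow 1).le
  · obtain ⟨s, hs⟩ := Submodule.Quotient.mk_surjective _
      (AdicCompletion.eval (maximalIdeal S) S n t)
    refine ⟨s, ?_⟩
    rw [hpow, AdicCompletion.mem_map_pow_iff hS, map_sub, sub_eq_zero, ← hs]
    rfl
  · rw [Ideal.mem_comap, hpow, AdicCompletion.mem_map_pow_iff hS] at hs
    have := (Submodule.Quotient.mk_eq_zero _).mp hs
    rwa [smul_eq_mul, Ideal.mul_top, ← h, ← Ideal.map_pow] at this

/-- for every Noetherian local ring `R` with residue field `κ` and every field
extension `κ → λ`, there is a scalar extension `R → S` with `S` a complete Noetherian local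
ring whose residue field is isomorphic to `λ` compatibly with the embedding `κ → λ`. -/
theorem exists_completion_along_residue_extension
    (R : Type u) [CommRing R] [IsNoetherianRing R] [IsLocalRing R]
    (lam : Type v) [Field lam] (i : ResidueField R →+* lam) :
    ∃ (S : Type (max u v)) (_ : CommRing S) (_ : IsNoetherianRing S) (_ : IsLocalRing S)
      (f : R →+* S) (_ : IsLocalHom f),
      IsScalarExtension f ∧ IsAdicComplete (maximalIdeal S) S ∧
      ∃ e : ResidueField S ≃+* lam,
        (e : ResidueField S →+* lam).comp (ResidueField.map f) = i := by
  obtain ⟨S, _, _, _, _, hm, j, hj⟩ := exists_isLocalRing_of_residueField_hom i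
  have hS : (maximalIdeal S).FG := hm ▸ (maximalIdeal R).fg_of_isNoetherianRing.map _
  let T := AdicCompletion (maximalIdeal S) S
  have : IsLocalRing T := AdicCompletion.isLocalRing_of_fg hS
  have : IsNoetherianRing T := AdicCompletion.isNoetherianRing_of_fg hS
  have : Module.Flat R T := AdicCompletion.flat_of_map_maximalIdeal_eq hm
  have hmT : (maximalIdeal R).map (algebraMap R T) = maximalIdeal T := by
    rw [IsScalarTower.algebraMap_eq R S T, ← Ideal.map_map, hm]
    exact (AdicCompletion.maximalIdeal_eq_map_of_fg hS).symm
  have : IsLocalHom (algebraMap R T) := ((local_hom_TFAE _).out 0 2).mpr hmT.le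
  have : IsLocalHom (algebraMap S T) := AdicCompletion.algebraMap_isLocalHom_of_fg hS
  refine ⟨T, inferInstance, ‹_›, ‹_›, algebraMap R T, ‹_›, ⟨?_, hmT⟩,
    AdicCompletion.isAdicComplete_of_fg hS,
    (RingEquiv.ofBijective _ (AdicCompletion.residueField_map_bijective_of_fg hS)).symm.trans j, ?_⟩
  · have : (algebraMap R T).toAlgebra = (inferInstance : Algebra R T) :=
      Algebra.algebra_ext _ _ fun _ => rfl
    rw [this]
    exact Module.FaithfullyFlat.of_flat_of_isLocalHom
  · refine RingHom.ext fun x => ?_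
    obtain ⟨r, rfl⟩ := residue_surjective x
    exact (congrArg j ((RingEquiv.symm_apply_eq _).mpr rfl)).trans (hj r)
end

section
/- Let R → S be a module-finite local homomorphism of Noetherian local rings inducing an isomorphism on residue fields, and let R → T be a scalar extension with T a complete Noetherian local ring. Then T ⊗_R S is a complete Noetherian local ring and the base-change map S → T ⊗_R S is a scalar extension. -/
open IsLocalRing TensorProduct

/-- A finite module over an `I`-adically precomplete ring is `I`-adically precomplete. -/
theorem IsPrecomplete.of_finite {R M : Type*} [CommRing R] (I : Ideal R) [IsPrecomplete I R]
    [AddCommGroup M] [Module R M] [Module.Finite R M] : IsPrecomplete I M := by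
  rw [← AdicCompletion.of_surjective_iff]
  intro y
  obtain ⟨z, rfl⟩ := AdicCompletion.ofTensorProduct_surjective_of_finite I M y
  induction z with
  | zero => exact ⟨0, by simp⟩
  | add a b ha hb =>
    obtain ⟨a', ha⟩ := ha
    obtain ⟨b', hb⟩ := hb
    exact ⟨a' + b', by rw [map_add, map_add, ha, hb]⟩
  | tmul r m =>
    obtain ⟨r, rfl⟩ := AdicCompletion.of_surjective I R r
    refine ⟨r • m, ?_⟩
    rw [AdicCompletion.ofTensorProduct_tmul]
    ext n
    rw [AdicCompletion.smul_eval]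
    rfl

/-- Precompleteness passes from an ideal `I` to a larger ideal having a power inside `I`. -/
theorem IsPrecomplete.of_le_of_pow_le {R M : Type*} [CommRing R] {I J : Ideal R}
    [AddCommGroup M] [Module R M] [hI : IsPrecomplete I M] (hIJ : I ≤ J) {k : ℕ}
    (hk : J ^ k ≤ I) : IsPrecomplete J M := by
  refine ⟨fun f hf ↦ ?_⟩
  have hk' : J ^ (k + 1) ≤ I := (Ideal.pow_le_pow_right k.le_succ).trans hk
  obtain ⟨L, hL⟩ := hI.prec (f := fun n ↦ f ((k + 1) * n)) fun {m n} hmn ↦ by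
    refine SModEq.mono (Submodule.smul_mono_left ?_) (hf (Nat.mul_le_mul_left (k + 1) hmn))
    rw [pow_mul]
    exact Ideal.pow_right_mono hk' m
  refine ⟨L, fun n ↦ (hf (Nat.le_mul_of_pos_left n k.succ_pos)).trans ?_⟩
  exact SModEq.mono (Submodule.smul_mono_left (Ideal.pow_right_mono hIJ n)) (hL n)

section Local

variable {R S : Type*} [CommRing R] [CommRing S] [IsLocalRing R] [IsLocalRing S] [Algebra R S]
  [Algebra.IsIntegral R S]

/-- In an integral local extension, the maximal ideal is the radical of the extension of the
maximal ideal of the base. -/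
theorem IsLocalRing.maximalIdeal_le_radical_map_of_isIntegral :
    maximalIdeal S ≤ ((maximalIdeal R).map (algebraMap R S)).radical := by
  rw [Ideal.radical_eq_sInf]
  refine le_sInf fun P ⟨hP, hPp⟩ ↦ ?_
  have hcomap : P.comap (algebraMap R S) = maximalIdeal R :=
    ((maximalIdeal.isMaximal R).eq_of_le (Ideal.IsPrime.comap _).ne_top
      (Ideal.map_le_iff_le_comap.mp hP)).symm
  have := Ideal.isMaximal_of_isIntegral_of_isMaximal_comap P
    (hcomap ▸ maximalIdeal.isMaximal R)
  exact (IsLocalRing.eq_maximalIdeal this).ge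

/-- A local ring that is module-finite over a complete Noetherian local ring is complete. -/
theorem IsLocalRing.isAdicComplete_of_finite [IsNoetherianRing R] [Module.Finite R S]
    [IsLocalHom (algebraMap R S)] [IsAdicComplete (maximalIdeal R) R] :
    IsAdicComplete (maximalIdeal S) S := by
  have : IsNoetherianRing S := IsNoetherianRing.of_finite R S
  have := IsPrecomplete.of_finite (maximalIdeal R) (M := S)
  have : IsPrecomplete ((maximalIdeal R).map (algebraMap R S)) S :=
    IsPrecomplete.map_algebraMap_iff.mpr this
  obtain ⟨k, hk⟩ := Ideal.exists_pow_le_of_le_radical_of_fg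
    (maximalIdeal_le_radical_map_of_isIntegral (R := R) (S := S))
    (maximalIdeal S).fg_of_isNoetherianRing
  have := IsPrecomplete.of_le_of_pow_le (M := S) (map_maximalIdeal_le _) hk
  constructor

end Local

section BaseChange

variable {R S T : Type*} [CommRing R] [CommRing S] [CommRing T] [Algebra R S] [Algebra R T]

attribute [local instance] Algebra.TensorProduct.rightAlgebra in
/-- Faithful flatness is stable under base change, with the base on the right. -/
theorem Module.FaithfullyFlat.tensorProduct_right [Module.FaithfullyFlat R T] :
    Module.FaithfullyFlat S (T ⊗[R] S) :=
  .of_linearEquiv S (S ⊗[R] T)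
    { __ := Algebra.TensorProduct.comm R T S
      map_smul' := fun s x ↦ by
        simp [Algebra.smul_def, Algebra.TensorProduct.right_algebraMap_apply] }

variable [IsLocalRing R] [IsLocalRing S]

/-- If `R → S` is surjective on residue fields, so is its base change `T → T ⊗[R] S`, modulo the
extension of the maximal ideal of `S`. -/
theorem surjective_mk_comp_includeLeft [IsLocalHom (algebraMap R S)]
    (hres : Function.Surjective (ResidueField.map (algebraMap R S))) :
    Function.Surjective ((Ideal.Quotient.mk ((maximalIdeal S).map
      (Algebra.TensorProduct.includeRight : S →ₐ[R] T ⊗[R] S))).comp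
        (algebraMap T (T ⊗[R] S))) := by
  intro y
  obtain ⟨x, rfl⟩ := Ideal.Quotient.mk_surjective y
  induction x with
  | zero => exact ⟨0, by simp⟩
  | add a b ha hb =>
    obtain ⟨a', ha⟩ := ha
    obtain ⟨b', hb⟩ := hb
    exact ⟨a' + b', by rw [map_add, map_add, ha, hb]⟩
  | tmul t s =>
    obtain ⟨r, hr⟩ := hres (residue S s)
    obtain ⟨r, rfl⟩ := residue_surjective r
    rw [ResidueField.map_residue] at hr
    have hmem : algebraMap R S r - s ∈ maximalIdeal S := Ideal.Quotient.eq.mp hr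
    refine ⟨r • t, Ideal.Quotient.eq.mpr ?_⟩
    have : algebraMap T (T ⊗[R] S) (r • t) - t ⊗ₜ s =
        (t ⊗ₜ 1) * (Algebra.TensorProduct.includeRight : S →ₐ[R] T ⊗[R] S)
          (algebraMap R S r - s) := by
      simp [Algebra.TensorProduct.algebraMap_apply, TensorProduct.tmul_sub, mul_sub,
        TensorProduct.smul_tmul', Algebra.algebraMap_eq_smul_one (A := S)]
    rw [this]
    exact Ideal.mul_mem_left _ _ (Ideal.mem_map_of_mem _ hmem)

attribute [local instance] Algebra.TensorProduct.rightAlgebra in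
/-- If moreover `R → T` is faithfully flat and unramified, the maximal ideal of `S` extends to a
maximal ideal of `T ⊗[R] S`. -/
theorem isMaximal_map_includeRight [IsLocalRing T] [IsLocalHom (algebraMap R S)]
    [Module.FaithfullyFlat R T]
    (hT : (maximalIdeal R).map (algebraMap R T) = maximalIdeal T)
    (hres : Function.Surjective (ResidueField.map (algebraMap R S))) :
    ((maximalIdeal S).map
      (Algebra.TensorProduct.includeRight : S →ₐ[R] T ⊗[R] S)).IsMaximal := by
  set n := (maximalIdeal S).map (Algebra.TensorProduct.includeRight : S →ₐ[R] T ⊗[R] S)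
  let φ := (Ideal.Quotient.mk n).comp (algebraMap T (T ⊗[R] S))
  have hφ : Function.Surjective φ := surjective_mk_comp_includeLeft hres
  have hne : n ≠ ⊤ := by
    have := Module.FaithfullyFlat.tensorProduct_right (R := R) (S := S) (T := T)
    intro h
    refine Module.FaithfullyFlat.submodule_ne_top (R := S) (M := T ⊗[R] S)
      (maximalIdeal.isMaximal S) ?_
    rw [Ideal.smul_top_eq_map]
    exact (Submodule.restrictScalars_eq_top_iff _ _ _).mpr h
  have : Nontrivial ((T ⊗[R] S) ⧸ n) := Ideal.Quotient.nontrivial_iff.mpr hne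
  have hle : maximalIdeal T ≤ RingHom.ker φ := by
    rw [← hT, Ideal.map_le_iff_le_comap]
    intro r hr
    have hr' : algebraMap R S r ∈ maximalIdeal S :=
      map_maximalIdeal_le _ (Ideal.mem_map_of_mem _ hr)
    have := Ideal.mem_map_of_mem (Algebra.TensorProduct.includeRight : S →ₐ[R] T ⊗[R] S) hr'
    rw [AlgHom.commutes, IsScalarTower.algebraMap_apply R T] at this
    exact Ideal.Quotient.eq_zero_iff_mem.mpr this
  have hker : RingHom.ker φ = maximalIdeal T :=
    ((maximalIdeal.isMaximal T).eq_of_le (RingHom.ker_ne_top φ) hle).symm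
  have : (RingHom.ker φ).IsMaximal := hker ▸ maximalIdeal.isMaximal T
  refine Ideal.Quotient.maximal_of_isField _ ?_
  exact (RingHom.quotientKerEquivOfSurjective hφ).symm.toMulEquiv.isField
    (Ideal.Quotient.field (RingHom.ker φ)).toIsField

attribute [local instance] Algebra.TensorProduct.rightAlgebra in
/-- Every maximal ideal of `T ⊗[R] S` contains the extension of the maximal ideal of `S`. -/
theorem map_includeRight_le_of_isMaximal [IsLocalRing T] [Module.Finite R S]
    [IsLocalHom (algebraMap R T)]
    (Q : Ideal (T ⊗[R] S)) [hQ : Q.IsMaximal] :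
    (maximalIdeal S).map (Algebra.TensorProduct.includeRight : S →ₐ[R] T ⊗[R] S) ≤ Q := by
  have hQT : Q.comap (algebraMap T (T ⊗[R] S)) = maximalIdeal T :=
    IsLocalRing.eq_maximalIdeal (Ideal.isMaximal_comap_of_isIntegral_of_isMaximal Q)
  have hQR : Q.comap (algebraMap R (T ⊗[R] S)) = maximalIdeal R := by
    rw [IsScalarTower.algebraMap_eq R T, ← Ideal.comap_comap, hQT]
    exact maximalIdeal_comap _
  set P := Q.comap (algebraMap S (T ⊗[R] S)) with hP
  have hPR : P.comap (algebraMap R S) = maximalIdeal R := by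
    rw [hP, Ideal.comap_comap, ← IsScalarTower.algebraMap_eq, hQR]
  have : P.IsPrime := Ideal.IsPrime.comap _
  have : P.IsMaximal := Ideal.isMaximal_of_isIntegral_of_isMaximal_comap (R := R) P
    (hPR ▸ maximalIdeal.isMaximal R)
  exact Ideal.map_le_iff_le_comap.mpr (IsLocalRing.eq_maximalIdeal this).ge

end BaseChange

/-- if `R → S` is a module-finite local homomorphism of Noetherian local rings
inducing an isomorphism on residue fields, and `R → T` is a scalar extension with `T` a complete
Noetherian local ring, then `T ⊗_R S` is a complete Noetherian local ring and the base-change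
map `S → T ⊗_R S` is a scalar extension. -/
theorem isScalarExtension_baseChange_finite
    (R S T : Type*) [CommRing R] [CommRing S] [CommRing T]
    [IsNoetherianRing R] [IsNoetherianRing S] [IsNoetherianRing T]
    [IsLocalRing R] [IsLocalRing S] [IsLocalRing T]
    [Algebra R S] [Algebra R T]
    [IsLocalHom (algebraMap R S)] [IsLocalHom (algebraMap R T)]
    [Module.Finite R S]
    (hres : Function.Bijective (ResidueField.map (algebraMap R S)))
    (hT : IsScalarExtension (algebraMap R T))
    (hTc : IsAdicComplete (maximalIdeal T) T) :
    ∃ _ : IsLocalRing (T ⊗[R] S),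
      IsNoetherianRing (T ⊗[R] S) ∧
      IsAdicComplete (maximalIdeal (T ⊗[R] S)) (T ⊗[R] S) ∧
      IsScalarExtension ((Algebra.TensorProduct.includeRight : S →ₐ[R] T ⊗[R] S) : S →+* T ⊗[R] S) := by
  have hmap := hT.2
  have hflat : Module.FaithfullyFlat R T := RingHom.faithfullyFlat_algebraMap_iff.mp hT.1
  have hmax := isMaximal_map_includeRight hmap hres.surjective
  have hloc : IsLocalRing (T ⊗[R] S) := .of_unique_max_ideal ⟨_, hmax, fun Q hQ ↦
    (hmax.eq_of_le hQ.ne_top (map_includeRight_le_of_isMaximal Q)).symm⟩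
  have hmaxeq := IsLocalRing.eq_maximalIdeal hmax
  have hlocal : IsLocalHom (algebraMap T (T ⊗[R] S)) :=
    ((local_hom_TFAE (algebraMap T (T ⊗[R] S))).out 0 4).mpr
      (IsLocalRing.eq_maximalIdeal (Ideal.isMaximal_comap_of_isIntegral_of_isMaximal _))
  exact ⟨hloc, IsNoetherianRing.of_finite T _, isAdicComplete_of_finite (R := T),
    Module.FaithfullyFlat.tensorProduct_right, hmaxeq⟩
end
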